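/- Let μ be a non-Dirac Borel probability measure on [0,∞) with m₁(μ) = 1, and for each n ≥ 2 let ν_n be a Borel probability measure on [0,∞) realizing μ^{⊠ n}. Set γ_n = 1/log(n). Then: if m₂(μ) < +∞, lim_{n→∞} (n/log(n)) · m_{γ_n}(ν_n) = e / Var(μ); and if m₂(μ) = +∞, lim_{n→∞} (n/log(n)) · m_{γ_n}(ν_n) = 0. -/

import Mathlib

open MeasureTheory Filter Topology Real

/-- The moment transform `ψ_μ(z) = ∫ z t / (1 - z t) dμ(t)` of a measure on `ℝ`. -/
noncomputable def psi (μ : Measure ℝ) (z : ℝ) : ℝ := ∫ t, z * t / (1 - z * t) ∂μ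

/-- `ν` realizes the `n`-fold free multiplicative convolution `μ^{⊠ n}`: with
`δ = μ({0})`, there is an inverse `χ : (δ-1,0) → (-∞,0)` of `ψ_μ` such that
`ψ_ν(((z+1)/z)^{n-1} · χ(z)^n) = z` on `(δ-1,0)` (this encodes `S_{μ^{⊠n}} = S_μ^n`). -/
def RealizesFreePower (μ ν : Measure ℝ) (n : ℕ) : Prop :=
  ∃ χ : ℝ → ℝ,
    (∀ z ∈ Set.Ioo ((μ {0}).toReal - 1) 0, χ z < 0 ∧ psi μ (χ z) = z) ∧
    (∀ z ∈ Set.Ioo ((μ {0}).toReal - 1) 0,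
      psi ν (((z + 1) / z) ^ (n - 1) * (χ z) ^ n) = z)

/-- The function `x ↦ -ψ_ρ(-x) = ∫ x t / (1 + x t) dρ(t)`. -/
noncomputable def negPsi (ρ : Measure ℝ) (x : ℝ) : ℝ := ∫ t, x * t / (1 + x * t) ∂ρ

lemma psi_neg (ρ : Measure ℝ) (x : ℝ) : psi ρ (-x) = -negPsi ρ x := by
  unfold psi negPsi
  rw [← integral_neg]
  congr 1
  ext t
  rw [neg_mul, neg_div, sub_neg_eq_add]

lemma ae_nonneg_of_measure_Iio {ρ : Measure ℝ} (h : ρ (Set.Iio 0) = 0) : ∀ᵐ t ∂ρ, 0 ≤ t := by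
  rw [ae_iff]
  simpa [Set.Iio] using h

lemma integrable_negPsi_integrand {ρ : Measure ℝ} [IsProbabilityMeasure ρ]
    (hρ : ∀ᵐ t ∂ρ, 0 ≤ t) {x : ℝ} (hx : 0 ≤ x) :
    Integrable (fun t => x * t / (1 + x * t)) ρ := by
  refine Integrable.of_bound (AEMeasurable.aestronglyMeasurable (by fun_prop)) 1 ?_
  filter_upwards [hρ] with t ht
  have : 0 ≤ x * t := mul_nonneg hx ht
  rw [Real.norm_of_nonneg (by positivity)]
  exact (div_le_one (by positivity)).2 (by linarith)

lemma negPsi_monotoneOn {ρ : Measure ℝ} [IsProbabilityMeasure ρ] (hρ : ∀ᵐ t ∂ρ, 0 ≤ t) :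
    MonotoneOn (negPsi ρ) (Set.Ici 0) := by
  intro y hy x hx hyx
  refine integral_mono_ae (integrable_negPsi_integrand hρ hy) (integrable_negPsi_integrand hρ hx) ?_
  filter_upwards [hρ] with t ht
  have h1 : 0 ≤ x * t := mul_nonneg hx ht
  have h2 : 0 ≤ y * t := mul_nonneg hy ht
  have h3 : y * t ≤ x * t := by gcongr
  rw [div_le_div_iff₀ (by positivity) (by positivity)]
  nlinarith

lemma negPsi_lt_negPsi {ρ : Measure ℝ} [IsProbabilityMeasure ρ] (hρ : ∀ᵐ t ∂ρ, 0 ≤ t)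
    {y x : ℝ} (hy : 0 ≤ y) (hyx : y < x) (hpos : 0 < negPsi ρ y) :
    negPsi ρ y < negPsi ρ x := by
  have hx : 0 ≤ x := hy.trans hyx.le
  refine lt_of_le_of_ne (negPsi_monotoneOn hρ hy hx hyx.le) fun heq => ?_
  have hi : Integrable (fun t => x * t / (1 + x * t) - y * t / (1 + y * t)) ρ :=
    (integrable_negPsi_integrand hρ hx).sub (integrable_negPsi_integrand hρ hy)
  have h0 : ∫ t, (x * t / (1 + x * t) - y * t / (1 + y * t)) ∂ρ = 0 := by
    rw [integral_sub (integrable_negPsi_integrand hρ hx) (integrable_negPsi_integrand hρ hy)]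
    exact sub_eq_zero.2 heq.symm
  have hid : ∀ t : ℝ, 0 ≤ t → x * t / (1 + x * t) - y * t / (1 + y * t) =
      (x - y) * t / ((1 + x * t) * (1 + y * t)) := by
    intro t ht
    have h1 : 0 ≤ x * t := mul_nonneg hx ht
    have h2 : 0 ≤ y * t := mul_nonneg hy ht
    field_simp
    ring
  rw [integral_eq_zero_iff_of_nonneg_ae _ hi] at h0
  · have : negPsi ρ y = ∫ t, (0 : ℝ) ∂ρ := by
      refine integral_congr_ae ?_
      filter_upwards [hρ, h0] with t ht h
      have h1 : 0 ≤ x * t := mul_nonneg hx ht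
      have h2 : 0 ≤ y * t := mul_nonneg hy ht
      simp only [Pi.zero_apply] at h
      rw [hid t ht, div_eq_zero_iff, mul_eq_zero] at h
      rcases h with (h | h) | h
      · linarith
      · simp [h]
      · have : 0 < (1 + x * t) * (1 + y * t) := by positivity
        linarith
    simp [this] at hpos
  · filter_upwards [hρ] with t ht
    have h1 : 0 ≤ x * t := mul_nonneg hx ht
    have h2 : 0 ≤ y * t := mul_nonneg hy ht
    have h3 : 0 ≤ x - y := by linarith
    simp only [Pi.zero_apply]
    rw [hid t ht]
    positivity

lemma negPsi_nonneg {ρ : Measure ℝ} (hρ : ∀ᵐ t ∂ρ, 0 ≤ t) {x : ℝ} (hx : 0 ≤ x) :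
    0 ≤ negPsi ρ x := by
  refine integral_nonneg_of_ae ?_
  filter_upwards [hρ] with t ht
  have h1 : 0 ≤ x * t := mul_nonneg hx ht
  simp only [Pi.zero_apply]
  positivity

lemma negPsi_le_one_sub {ρ : Measure ℝ} [IsProbabilityMeasure ρ] (hρ : ∀ᵐ t ∂ρ, 0 ≤ t)
    {x : ℝ} (hx : 0 ≤ x) : negPsi ρ x ≤ 1 - (ρ {0}).toReal := by
  have h1 : ∫ t, Set.indicator ({0}ᶜ) (fun _ => (1 : ℝ)) t ∂ρ = 1 - (ρ {0}).toReal := by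
    rw [integral_indicator_const _ (measurableSet_singleton 0).compl, smul_eq_mul, mul_one,
      probReal_compl_eq_one_sub (measurableSet_singleton 0)]
    rfl
  rw [← h1]
  refine integral_mono_ae (integrable_negPsi_integrand hρ hx)
    ((integrable_const 1).indicator (measurableSet_singleton 0).compl) ?_
  filter_upwards [hρ] with t ht
  have h1 : 0 ≤ x * t := mul_nonneg hx ht
  by_cases h : t = 0
  · simp [h]
  · rw [Set.indicator_of_mem (by simpa using h)]
    exact (div_le_one (by positivity)).2 (by linarith)

lemma negPsi_eq_mul (μ : Measure ℝ) (s : ℝ) : negPsi μ s = s * ∫ t, t / (1 + s * t) ∂μ := by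
  rw [negPsi, ← integral_const_mul]
  congr 1
  ext t
  ring

lemma integrable_div_one_add {μ : Measure ℝ} (hμ : ∀ᵐ t ∂μ, 0 ≤ t)
    (hm1 : Integrable (fun t : ℝ => t) μ) {s : ℝ} (hs : 0 ≤ s) : Integrable (fun t => t / (1 + s * t)) μ := by
  refine hm1.mono' (AEMeasurable.aestronglyMeasurable (by fun_prop)) ?_
  filter_upwards [hμ] with t ht
  have h1 : 0 ≤ s * t := mul_nonneg hs ht
  rw [Real.norm_of_nonneg (by positivity)]
  exact div_le_self ht (by linarith)

section UnitMean

variable {μ : Measure ℝ} [IsProbabilityMeasure μ]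

lemma integrable_sq_div_one_add (hμ : ∀ᵐ t ∂μ, 0 ≤ t) (hm1 : Integrable (fun t : ℝ => t) μ)
    {s : ℝ} (hs : 0 < s) : Integrable (fun t => (1 - t) ^ 2 / (1 + s * t)) μ := by
  refine ((integrable_const (1 : ℝ)).add (hm1.div_const s)).mono'
    (AEMeasurable.aestronglyMeasurable (by fun_prop)) ?_
  filter_upwards [hμ] with t ht
  have h1 : 0 ≤ s * t := mul_nonneg hs.le ht
  rw [Real.norm_of_nonneg (by positivity), div_le_iff₀ (by positivity)]
  simp only [Pi.add_apply]
  have : (1 + t / s) * (1 + s * t) = 1 + s * t + t / s + t ^ 2 := by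
    field_simp
    ring
  rw [this]
  have : 0 ≤ t / s := by positivity
  nlinarith

lemma one_sub_mul_integral_div (hμ : ∀ᵐ t ∂μ, 0 ≤ t) (hm1 : Integrable (fun t : ℝ => t) μ)
    (hmean : ∫ t, t ∂μ = 1) {s : ℝ} (hs : 0 < s) :
    1 - (1 + s) * ∫ t, t / (1 + s * t) ∂μ =
      s / (1 + s) * ∫ t, (1 - t) ^ 2 / (1 + s * t) ∂μ := by
  have hB := integrable_div_one_add hμ hm1 hs.le
  have h : ∫ t, s / (1 + s) * ((1 - t) ^ 2 / (1 + s * t)) ∂μ =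
      ∫ t, ((1 - (1 + s) * (t / (1 + s * t))) - (1 - t) / (1 + s)) ∂μ := by
    refine integral_congr_ae ?_
    filter_upwards [hμ] with t ht
    have h1 : 0 ≤ s * t := mul_nonneg hs.le ht
    field_simp
    ring
  have hi1 : Integrable (fun t => 1 - (1 + s) * (t / (1 + s * t))) μ :=
    (integrable_const 1).sub (hB.const_mul _)
  have hi2 : Integrable (fun t : ℝ => 1 - t) μ := (integrable_const 1).sub hm1
  rw [integral_const_mul, integral_sub hi1 (hi2.div_const _),
    integral_sub (integrable_const 1) (hB.const_mul _), integral_div,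
    integral_sub (integrable_const 1) hm1, integral_const_mul, hmean] at h
  simp at h
  linarith

/-- Expansion of the `S`-transform of a unit-mean measure in terms of `s = -χ(-u)`. -/
lemma sTransform_eq_one_add (hμ : ∀ᵐ t ∂μ, 0 ≤ t) (hm1 : Integrable (fun t : ℝ => t) μ)
    (hmean : ∫ t, t ∂μ = 1) {s u : ℝ} (hs : 0 < s) (hu : 0 < u) (hsu : negPsi μ s = u) :
    (1 - u) / u * s = 1 + u * ((∫ t, (1 - t) ^ 2 / (1 + s * t) ∂μ) /
      ((1 + s) * (∫ t, t / (1 + s * t) ∂μ) ^ 2)) := by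
  have h := one_sub_mul_integral_div hμ hm1 hmean hs
  rw [negPsi_eq_mul] at hsu
  set B := ∫ t, t / (1 + s * t) ∂μ
  set C := ∫ t, (1 - t) ^ 2 / (1 + s * t) ∂μ
  have hB : 0 < B := by
    by_contra hB
    nlinarith [mul_nonneg hs.le (neg_nonneg.2 (not_lt.1 hB))]
  have hC : C = (1 - (1 + s) * B) * (1 + s) / s := by
    rw [h]
    field_simp
  rw [hC, ← hsu]
  field_simp
  ring

lemma integral_div_one_add_le (hμ : ∀ᵐ t ∂μ, 0 ≤ t) (hm1 : Integrable (fun t : ℝ => t) μ)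
    (hmean : ∫ t, t ∂μ = 1) {s : ℝ} (hs : 0 < s) :
    (1 + s) * ∫ t, t / (1 + s * t) ∂μ ≤ 1 := by
  have h := one_sub_mul_integral_div hμ hm1 hmean hs
  have : 0 ≤ ∫ t, (1 - t) ^ 2 / (1 + s * t) ∂μ := by
    refine integral_nonneg_of_ae ?_
    filter_upwards [hμ] with t ht
    have h1 : 0 ≤ s * t := mul_nonneg hs.le ht
    simp only [Pi.zero_apply]
    positivity
  have : 0 ≤ s / (1 + s) * ∫ t, (1 - t) ^ 2 / (1 + s * t) ∂μ := by positivity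
  linarith

lemma one_add_mul_le_sTransform (hμ : ∀ᵐ t ∂μ, 0 ≤ t) (hm1 : Integrable (fun t : ℝ => t) μ)
    (hmean : ∫ t, t ∂μ = 1) {s u : ℝ} (hs : 0 < s) (hu : 0 < u) (hsu : negPsi μ s = u) :
    1 + (∫ t, (1 - t) ^ 2 / (1 + 1 * t) ∂μ) * u ≤ (1 - u) / u * s := by
  rw [sTransform_eq_one_add hμ hm1 hmean hs hu hsu]
  have h := integral_div_one_add_le hμ hm1 hmean hs
  rw [negPsi_eq_mul] at hsu
  set B := ∫ t, t / (1 + s * t) ∂μ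
  have hB : 0 < B := by
    by_contra hB
    nlinarith [mul_nonneg hs.le (neg_nonneg.2 (not_lt.1 hB))]
  have hC : (1 + s)⁻¹ * (∫ t, (1 - t) ^ 2 / (1 + 1 * t) ∂μ) ≤
      ∫ t, (1 - t) ^ 2 / (1 + s * t) ∂μ := by
    rw [← integral_const_mul]
    refine integral_mono_ae ((integrable_sq_div_one_add hμ hm1 one_pos).const_mul _)
      (integrable_sq_div_one_add hμ hm1 hs) ?_
    filter_upwards [hμ] with t ht
    have h1 : 0 ≤ s * t := mul_nonneg hs.le ht
    rw [inv_mul_eq_div, div_div]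
    gcongr
    nlinarith
  have h2 : (1 + s) * B ^ 2 ≤ (1 + s)⁻¹ := by
    rw [← one_div, le_div_iff₀ (by positivity)]
    have : (1 + s) * B ^ 2 * (1 + s) = ((1 + s) * B) ^ 2 := by ring
    rw [this]
    exact pow_le_one₀ (by positivity) h
  rw [mul_comm _ u]
  gcongr
  rw [le_div_iff₀ (by positivity)]
  refine le_trans ?_ hC
  rw [mul_comm (1 + s)⁻¹]
  gcongr
  refine integral_nonneg_of_ae ?_
  filter_upwards [hμ] with t ht
  simp only [Pi.zero_apply]
  positivity

lemma integral_sq_div_one_add_pos (hμ : ∀ᵐ t ∂μ, 0 ≤ t) (hm1 : Integrable (fun t : ℝ => t) μ)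
    (hnd : ∀ a : ℝ, μ ≠ Measure.dirac a) : 0 < ∫ t, (1 - t) ^ 2 / (1 + 1 * t) ∂μ := by
  have hnn : 0 ≤ᵐ[μ] fun t => (1 - t) ^ 2 / (1 + 1 * t) := by
    filter_upwards [hμ] with t ht
    simp only [Pi.zero_apply]
    positivity
  refine lt_of_le_of_ne (integral_nonneg_of_ae hnn) fun h => ?_
  have h0 := (integral_eq_zero_iff_of_nonneg_ae hnn
    (integrable_sq_div_one_add hμ hm1 one_pos)).1 h.symm
  have h1 : ∀ᵐ t ∂μ, t = 1 := by
    filter_upwards [hμ, h0] with t ht h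
    simp only [Pi.zero_apply, div_eq_zero_iff] at h
    rcases h with h | h
    · nlinarith
    · linarith
  have h2 := (ProbabilityTheory.hasLaw_dirac_of_ae_eq (𝓧 := ℝ)
    (m𝓧 := inferInstance) (P := μ) (X := id) (x := (1 : ℝ)) h1).map_eq
  rw [Measure.map_id] at h2
  exact hnd 1 h2

end UnitMean

lemma tendsto_integral_div_one_add {μ : Measure ℝ} (hμ : ∀ᵐ t ∂μ, 0 ≤ t)
    (hm1 : Integrable (fun t : ℝ => t) μ) (hmean : ∫ t, t ∂μ = 1) :
    Tendsto (fun s => ∫ t, t / (1 + s * t) ∂μ) (𝓝[>] 0) (𝓝 1) := by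
  suffices Tendsto (fun s => ∫ t, t / (1 + s * t) ∂μ) (𝓝[>] 0) (𝓝 (∫ t, t ∂μ)) by
    rwa [hmean] at this
  refine tendsto_integral_filter_of_dominated_convergence (fun t => t)
    (Eventually.of_forall fun s => AEMeasurable.aestronglyMeasurable (by fun_prop)) ?_ hm1 ?_
  · filter_upwards [self_mem_nhdsWithin] with s hs
    filter_upwards [hμ] with t ht
    have h1 : 0 ≤ s * t := mul_nonneg (le_of_lt hs) ht
    rw [Real.norm_of_nonneg (by positivity)]
    exact div_le_self ht (by linarith)
  · refine ae_of_all _ fun t => tendsto_nhdsWithin_of_tendsto_nhds ?_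
    have : ContinuousAt (fun s => t / (1 + s * t)) 0 := by
      refine ContinuousAt.div (by fun_prop) (by fun_prop) (by simp)
    simpa [ContinuousAt] using this

section Asymptotics

variable {μ : Measure ℝ} [IsProbabilityMeasure μ]

lemma tendsto_integral_sq_div_one_add (hμ : ∀ᵐ t ∂μ, 0 ≤ t)
    (hm1 : Integrable (fun t : ℝ => t) μ) (hmean : ∫ t, t ∂μ = 1)
    (hm2 : Integrable (fun t : ℝ => t ^ 2) μ) :
    Tendsto (fun s => ∫ t, (1 - t) ^ 2 / (1 + s * t) ∂μ) (𝓝[>] 0)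
      (𝓝 ((∫ t, t ^ 2 ∂μ) - (∫ t, t ∂μ) ^ 2)) := by
  have heq : ∀ t : ℝ, (1 - t) ^ 2 = 1 - 2 * t + t ^ 2 := fun t => by ring
  have hi1 : Integrable (fun t : ℝ => 1 - 2 * t) μ := (integrable_const 1).sub (hm1.const_mul 2)
  have hint : Integrable (fun t : ℝ => (1 - t) ^ 2) μ := by
    simp only [heq]
    exact hi1.add hm2
  have hval : (∫ t, t ^ 2 ∂μ) - (∫ t, t ∂μ) ^ 2 = ∫ t, (1 - t) ^ 2 ∂μ := by
    simp only [heq]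
    rw [integral_add hi1 hm2, integral_sub (integrable_const 1) (hm1.const_mul 2),
      integral_const_mul, hmean]
    simp
    ring
  rw [hval]
  refine tendsto_integral_filter_of_dominated_convergence (fun t => (1 - t) ^ 2)
    (Eventually.of_forall fun s => AEMeasurable.aestronglyMeasurable (by fun_prop)) ?_ hint ?_
  · filter_upwards [self_mem_nhdsWithin] with s hs
    filter_upwards [hμ] with t ht
    have h1 : 0 ≤ s * t := mul_nonneg (le_of_lt hs) ht
    rw [Real.norm_of_nonneg (by positivity)]
    exact div_le_self (by positivity) (by linarith)
  · refine ae_of_all _ fun t => tendsto_nhdsWithin_of_tendsto_nhds ?_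
    have : ContinuousAt (fun s => (1 - t) ^ 2 / (1 + s * t)) 0 := by
      refine ContinuousAt.div (by fun_prop) (by fun_prop) (by simp)
    simpa [ContinuousAt] using this

lemma variance_pos_of_not_dirac (hμ : ∀ᵐ t ∂μ, 0 ≤ t)
    (hm1 : Integrable (fun t : ℝ => t) μ) (hmean : ∫ t, t ∂μ = 1)
    (hm2 : Integrable (fun t : ℝ => t ^ 2) μ) (hnd : ∀ a : ℝ, μ ≠ Measure.dirac a) :
    0 < (∫ t, t ^ 2 ∂μ) - (∫ t, t ∂μ) ^ 2 := by
  refine (integral_sq_div_one_add_pos hμ hm1 hnd).trans_le ?_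
  refine ge_of_tendsto (tendsto_integral_sq_div_one_add hμ hm1 hmean hm2) ?_
  filter_upwards [Ioo_mem_nhdsGT (zero_lt_one' ℝ)] with s hs
  refine integral_mono_ae (integrable_sq_div_one_add hμ hm1 one_pos)
    (integrable_sq_div_one_add hμ hm1 hs.1) ?_
  filter_upwards [hμ] with t ht
  have h1 : 0 ≤ s * t := mul_nonneg hs.1.le ht
  gcongr
  exact hs.2.le

lemma tendsto_integral_sq_div_one_add_atTop (hμ : ∀ᵐ t ∂μ, 0 ≤ t)
    (hm1 : Integrable (fun t : ℝ => t) μ) (hm2 : ¬ Integrable (fun t : ℝ => t ^ 2) μ) :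
    Tendsto (fun s => ∫ t, (1 - t) ^ 2 / (1 + s * t) ∂μ) (𝓝[>] 0) atTop := by
  have htop : ∫⁻ t, ENNReal.ofReal ((1 - t) ^ 2) ∂μ = ⊤ := by
    by_contra h
    have hint : Integrable (fun t : ℝ => (1 - t) ^ 2) μ := by
      refine ⟨by fun_prop, ?_⟩
      rw [hasFiniteIntegral_iff_ofReal (ae_of_all _ fun t => by positivity)]
      exact lt_top_iff_ne_top.2 h
    refine hm2 ?_
    have : (fun t : ℝ => t ^ 2) = fun t => (1 - t) ^ 2 - (1 - 2 * t) := by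
      ext t
      ring
    rw [this]
    exact hint.sub ((integrable_const 1).sub (hm1.const_mul 2))
  have hlim : Tendsto (fun n : ℕ =>
      ∫⁻ t, ENNReal.ofReal ((1 - t) ^ 2 / (1 + 1 / ((n : ℝ) + 1) * t)) ∂μ)
      atTop (𝓝 (∫⁻ t, ENNReal.ofReal ((1 - t) ^ 2) ∂μ)) := by
    refine lintegral_tendsto_of_tendsto_of_monotone (fun n => by fun_prop) ?_ ?_
    · filter_upwards [hμ] with t ht m n hmn
      beta_reduce
      gcongr
    · refine ae_of_all _ fun t => (ENNReal.continuous_ofReal.tendsto _).comp ?_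
      have : ContinuousAt (fun s => (1 - t) ^ 2 / (1 + s * t)) 0 := by
        refine ContinuousAt.div (by fun_prop) (by fun_prop) (by simp)
      have := this.tendsto.comp tendsto_one_div_add_atTop_nhds_zero_nat
      simpa [Function.comp_def] using this
  rw [htop] at hlim
  refine tendsto_atTop.2 fun M => ?_
  obtain ⟨n, hn⟩ := ((ENNReal.tendsto_nhds_top_iff_nnreal.1 hlim) M.toNNReal).exists
  have hpos : 0 < 1 / ((n : ℝ) + 1) := by positivity
  have hnn : 0 ≤ᵐ[μ] fun t => (1 - t) ^ 2 / (1 + 1 / ((n : ℝ) + 1) * t) := by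
    filter_upwards [hμ] with t ht
    simp only [Pi.zero_apply]
    positivity
  rw [← ofReal_integral_eq_lintegral_ofReal (integrable_sq_div_one_add hμ hm1 hpos) hnn] at hn
  have hM : M < ∫ t, (1 - t) ^ 2 / (1 + 1 / ((n : ℝ) + 1) * t) ∂μ :=
    (ENNReal.ofReal_lt_ofReal_iff'.1 hn).1
  filter_upwards [Ioo_mem_nhdsGT hpos] with s hs
  refine hM.le.trans (integral_mono_ae (integrable_sq_div_one_add hμ hm1 hpos)
    (integrable_sq_div_one_add hμ hm1 hs.1) ?_)
  filter_upwards [hμ] with t ht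
  have h1 : 0 ≤ s * t := mul_nonneg hs.1.le ht
  gcongr
  exact hs.2.le

lemma negPsi_pos (hμ : ∀ᵐ t ∂μ, 0 ≤ t) (hmean : ∫ t, t ∂μ = 1) {ε : ℝ} (hε : 0 < ε) :
    0 < negPsi μ ε := by
  refine lt_of_le_of_ne (negPsi_nonneg hμ hε.le) fun h => ?_
  have hnn : 0 ≤ᵐ[μ] fun t => ε * t / (1 + ε * t) := by
    filter_upwards [hμ] with t ht
    have h1 : 0 ≤ ε * t := mul_nonneg hε.le ht
    simp only [Pi.zero_apply]
    positivity
  have h0 := (integral_eq_zero_iff_of_nonneg_ae hnn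
    (integrable_negPsi_integrand hμ hε.le)).1 h.symm
  have : ∫ t, t ∂μ = ∫ t, (0 : ℝ) ∂μ := by
    refine integral_congr_ae ?_
    filter_upwards [hμ, h0] with t ht h
    have h1 : 0 ≤ ε * t := mul_nonneg hε.le ht
    simp only [Pi.zero_apply, div_eq_zero_iff, mul_eq_zero] at h
    rcases h with (h | h) | h
    · linarith
    · exact h
    · linarith
  simp [hmean] at this

/-- A right inverse of `negPsi μ` tends to zero at zero. -/
lemma tendsto_negPsi_inverse_zero (hμ : ∀ᵐ t ∂μ, 0 ≤ t) (hmean : ∫ t, t ∂μ = 1)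
    {a : ℝ} (ha : 0 < a) {s : ℝ → ℝ} (hs : ∀ u ∈ Set.Ioo 0 a, 0 < s u ∧ negPsi μ (s u) = u) :
    Tendsto s (𝓝[>] 0) (𝓝[>] 0) := by
  refine tendsto_nhdsWithin_iff.2 ⟨?_, ?_⟩
  · rw [Metric.tendsto_nhds]
    intro ε hε
    filter_upwards [Ioo_mem_nhdsGT ha, Ioo_mem_nhdsGT (negPsi_pos hμ hmean hε)] with u hu hu2
    obtain ⟨h1, h2⟩ := hs u hu
    rw [Real.dist_0_eq_abs, abs_of_pos h1]
    by_contra h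
    have := negPsi_monotoneOn hμ hε.le h1.le (not_lt.1 h)
    rw [h2] at this
    exact absurd hu2.2 (not_lt.2 this)
  · filter_upwards [Ioo_mem_nhdsGT ha] with u hu
    exact (hs u hu).1

end Asymptotics

section MomentFormula

/-- The constant `∫₀^∞ y^{-γ} / (1 + y) dy`. -/
noncomputable def stieltjesConst (γ : ℝ) : ℝ := ∫ y in Set.Ioi 0, y ^ (-γ) / (1 + y)

lemma integral_Ioc_rpow_neg {γ : ℝ} (h1 : γ < 1) :
    ∫ y in Set.Ioc (0 : ℝ) 1, y ^ (-γ) = 1 / (1 - γ) := by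
  rw [← intervalIntegral.integral_of_le zero_le_one, integral_rpow (Or.inl (by linarith)),
    Real.one_rpow, Real.zero_rpow (by linarith)]
  congr 1 <;> ring

lemma integrableOn_Ioc_rpow_neg {γ : ℝ} (h1 : γ < 1) :
    IntegrableOn (fun y : ℝ => y ^ (-γ)) (Set.Ioc 0 1) := by
  rw [integrableOn_Ioc_iff_integrableOn_Ioo]
  exact (intervalIntegral.integrableOn_Ioo_rpow_iff one_pos).2 (by linarith)

lemma integrableOn_rpow_div_one_add {γ : ℝ} (h0 : 0 < γ) (h1 : γ < 1) :
    IntegrableOn (fun y : ℝ => y ^ (-γ) / (1 + y)) (Set.Ioc 0 1) ∧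
    IntegrableOn (fun y : ℝ => y ^ (-γ) / (1 + y)) (Set.Ioi 1) := by
  constructor
  · refine Integrable.mono' (integrableOn_Ioc_rpow_neg h1)
      (AEMeasurable.aestronglyMeasurable (by fun_prop)) ?_
    filter_upwards [ae_restrict_mem measurableSet_Ioc] with y hy
    have := hy.1
    rw [Real.norm_of_nonneg (by positivity)]
    exact div_le_self (by positivity) (by linarith)
  · refine Integrable.mono' (integrableOn_Ioi_rpow_of_lt (a := -γ - 1) (by linarith) one_pos)
      (AEMeasurable.aestronglyMeasurable (by fun_prop)) ?_
    filter_upwards [ae_restrict_mem measurableSet_Ioi] with y hy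
    have : 0 < y := one_pos.trans hy
    rw [Real.norm_of_nonneg (by positivity), Real.rpow_sub_one this.ne']
    gcongr
    linarith

lemma stieltjesConst_eq {γ : ℝ} (h0 : 0 < γ) (h1 : γ < 1) :
    stieltjesConst γ = (∫ y in Set.Ioc (0 : ℝ) 1, y ^ (-γ) / (1 + y)) +
      ∫ y in Set.Ioi (1 : ℝ), y ^ (-γ) / (1 + y) := by
  obtain ⟨ha, hb⟩ := integrableOn_rpow_div_one_add h0 h1
  rw [stieltjesConst, ← setIntegral_union (by simp) measurableSet_Ioi ha hb,
    Set.Ioc_union_Ioi_eq_Ioi zero_le_one]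

lemma stieltjesConst_le {γ : ℝ} (h0 : 0 < γ) (h1 : γ < 1) :
    stieltjesConst γ ≤ 1 / (1 - γ) + 1 / γ := by
  obtain ⟨ha, hb⟩ := integrableOn_rpow_div_one_add h0 h1
  rw [stieltjesConst_eq h0 h1]
  refine add_le_add ?_ ?_
  · rw [← integral_Ioc_rpow_neg h1]
    refine setIntegral_mono_on ha (integrableOn_Ioc_rpow_neg h1) measurableSet_Ioc fun y hy => ?_
    have := hy.1
    exact div_le_self (by positivity) (by linarith)
  · have : (1 : ℝ) / γ = ∫ y in Set.Ioi (1 : ℝ), y ^ (-γ - 1) := by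
      have e : -γ - 1 + 1 = -γ := by ring
      rw [integral_Ioi_rpow_of_lt (by linarith) one_pos, Real.one_rpow, e, neg_div_neg_eq]
    rw [this]
    refine setIntegral_mono_on hb (integrableOn_Ioi_rpow_of_lt (by linarith) one_pos)
      measurableSet_Ioi fun y hy => ?_
    have hy0 : 0 < y := one_pos.trans hy
    rw [Real.rpow_sub_one hy0.ne']
    gcongr
    linarith

lemma le_stieltjesConst {γ : ℝ} (h0 : 0 < γ) (h1 : γ < 1) :
    1 / γ - 1 / (1 + γ) ≤ stieltjesConst γ := by
  obtain ⟨ha, hb⟩ := integrableOn_rpow_div_one_add h0 h1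
  rw [stieltjesConst_eq h0 h1]
  have h2 : 0 ≤ ∫ y in Set.Ioc (0 : ℝ) 1, y ^ (-γ) / (1 + y) := by
    refine setIntegral_nonneg measurableSet_Ioc fun y hy => ?_
    have := hy.1
    positivity
  have hi1 := integrableOn_Ioi_rpow_of_lt (a := -γ - 1) (by linarith) one_pos
  have hi2 := integrableOn_Ioi_rpow_of_lt (a := -γ - 2) (by linarith) one_pos
  have h3 : 1 / γ - 1 / (1 + γ) =
      ∫ y in Set.Ioi (1 : ℝ), (y ^ (-γ - 1) - y ^ (-γ - 2)) := by
    rw [integral_sub hi1 hi2, integral_Ioi_rpow_of_lt (by linarith) one_pos,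
      integral_Ioi_rpow_of_lt (by linarith) one_pos, Real.one_rpow, Real.one_rpow]
    have e1 : -γ - 1 + 1 = -γ := by ring
    have e2 : -γ - 2 + 1 = -(1 + γ) := by ring
    rw [e1, e2, neg_div_neg_eq, neg_div_neg_eq]
  have h4 : 1 / γ - 1 / (1 + γ) ≤ ∫ y in Set.Ioi (1 : ℝ), y ^ (-γ) / (1 + y) := by
    rw [h3]
    refine setIntegral_mono_on (hi1.sub hi2) hb measurableSet_Ioi fun y hy => ?_
    have hy0 : 0 < y := one_pos.trans hy
    have e : y ^ (-γ - 2) = y ^ (-γ) / y ^ 2 := by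
      rw [Real.rpow_sub hy0]
      norm_num
    rw [Real.rpow_sub_one hy0.ne', e]
    have hp : 0 < y ^ (-γ) := Real.rpow_pos_of_pos hy0 _
    rw [← sub_nonneg]
    have : y ^ (-γ) / (1 + y) - (y ^ (-γ) / y - y ^ (-γ) / y ^ 2) =
        y ^ (-γ) / ((1 + y) * y ^ 2) := by
      field_simp
      ring
    rw [this]
    positivity
  linarith

lemma tendsto_mul_stieltjesConst :
    Tendsto (fun γ => γ * stieltjesConst γ) (𝓝[>] 0) (𝓝 1) := by
  have hl : Tendsto (fun γ : ℝ => 1 - γ / (1 + γ)) (𝓝[>] 0) (𝓝 1) := by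
    refine tendsto_nhdsWithin_of_tendsto_nhds ?_
    have : ContinuousAt (fun γ : ℝ => 1 - γ / (1 + γ)) 0 :=
      continuousAt_const.sub (ContinuousAt.div (by fun_prop) (by fun_prop) (by simp))
    simpa [ContinuousAt] using this
  have hr : Tendsto (fun γ : ℝ => γ / (1 - γ) + 1) (𝓝[>] 0) (𝓝 1) := by
    refine tendsto_nhdsWithin_of_tendsto_nhds ?_
    have : ContinuousAt (fun γ : ℝ => γ / (1 - γ) + 1) 0 :=
      (ContinuousAt.div (by fun_prop) (by fun_prop) (by simp)).add continuousAt_const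
    simpa [ContinuousAt] using this
  refine tendsto_of_tendsto_of_tendsto_of_le_of_le' hl hr ?_ ?_
  · filter_upwards [Ioo_mem_nhdsGT (zero_lt_one' ℝ)] with γ hγ
    have h := mul_le_mul_of_nonneg_left (le_stieltjesConst hγ.1 hγ.2) hγ.1.le
    have := hγ.1
    refine le_trans (le_of_eq ?_) h
    field_simp
  · filter_upwards [Ioo_mem_nhdsGT (zero_lt_one' ℝ)] with γ hγ
    have h := mul_le_mul_of_nonneg_left (stieltjesConst_le hγ.1 hγ.2) hγ.1.le
    have := hγ.1
    refine h.trans (le_of_eq ?_)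
    have : 1 - γ ≠ 0 := by linarith [hγ.2]
    field_simp

lemma lintegral_rpow_mul_div_one_add {γ : ℝ} (h0 : 0 < γ) (h1 : γ < 1) {t : ℝ} (ht : 0 ≤ t) :
    ∫⁻ x in Set.Ioi (0 : ℝ), ENNReal.ofReal (x ^ (-γ - 1) * (x * t / (1 + x * t))) =
      ENNReal.ofReal (stieltjesConst γ) * ENNReal.ofReal (t ^ γ) := by
  rcases ht.eq_or_lt with rfl | ht
  · simp [Real.zero_rpow h0.ne']
  have hint : IntegrableOn (fun y : ℝ => y ^ (-γ) / (1 + y)) (Set.Ioi 0) := by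
    rw [← Set.Ioc_union_Ioi_eq_Ioi zero_le_one]
    exact (integrableOn_rpow_div_one_add h0 h1).1.union (integrableOn_rpow_div_one_add h0 h1).2
  have hcongr : ∀ x ∈ Set.Ioi (0 : ℝ), x ^ (-γ - 1) * (x * t / (1 + x * t)) =
      t ^ (γ + 1) * ((t * x) ^ (-γ) / (1 + t * x)) := by
    intro x hx
    have hx : 0 < x := hx
    rw [Real.rpow_sub_one hx.ne', Real.mul_rpow ht.le hx.le, Real.rpow_add_one ht.ne',
      Real.rpow_neg ht.le]
    have := Real.rpow_pos_of_pos ht γ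
    field_simp
  have hI : ∫ x in Set.Ioi (0 : ℝ), x ^ (-γ - 1) * (x * t / (1 + x * t)) =
      stieltjesConst γ * t ^ γ := by
    rw [setIntegral_congr_fun measurableSet_Ioi hcongr, integral_const_mul,
      integral_comp_mul_left_Ioi (fun y : ℝ => y ^ (-γ) / (1 + y)) 0 ht, mul_zero,
      Real.rpow_add_one ht.ne', smul_eq_mul, stieltjesConst]
    field_simp
  have hint2 : IntegrableOn (fun x : ℝ => x ^ (-γ - 1) * (x * t / (1 + x * t))) (Set.Ioi 0) := by
    rw [integrableOn_congr_fun hcongr measurableSet_Ioi]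
    refine Integrable.const_mul ?_ _
    exact (integrableOn_Ioi_comp_mul_left_iff (fun y : ℝ => y ^ (-γ) / (1 + y)) 0 ht).2
      (by rwa [mul_zero])
  rw [← ENNReal.ofReal_mul' (by positivity), ← hI, ofReal_integral_eq_lintegral_ofReal hint2]
  filter_upwards [ae_restrict_mem measurableSet_Ioi] with x hx
  have hx : 0 < x := hx
  simp only [Pi.zero_apply]
  positivity

/-- The fractional moment of `ρ` in terms of a right inverse `X` of `negPsi ρ`. -/
lemma stieltjesConst_mul_integral_rpow {ρ : Measure ℝ} [IsProbabilityMeasure ρ]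
    (hρ : ∀ᵐ t ∂ρ, 0 ≤ t) {γ : ℝ} (h0 : 0 < γ) (h1 : γ < 1) {a : ℝ} {X : ℝ → ℝ}
    (hX : ∀ u ∈ Set.Ioo 0 a, 0 < X u ∧ negPsi ρ (X u) = u)
    (hle : ∀ x, 0 < x → negPsi ρ x ≤ a) :
    stieltjesConst γ * ∫ t, t ^ γ ∂ρ = γ⁻¹ * ∫ u in Set.Ioo 0 a, X u ^ (-γ) := by
  have hXmono : MonotoneOn X (Set.Ioo 0 a) := by
    intro u hu v hv huv
    by_contra h
    have := negPsi_lt_negPsi hρ (hX v hv).1.le (not_le.1 h) (by rw [(hX v hv).2]; exact hv.1)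
    rw [(hX u hu).2, (hX v hv).2] at this
    linarith
  have hXm : AEMeasurable X (volume.restrict (Set.Ioo 0 a)) :=
    aemeasurable_restrict_of_monotoneOn measurableSet_Ioo hXmono
  have hFm : Measurable (negPsi ρ) := by
    refine StronglyMeasurable.measurable (StronglyMeasurable.integral_prod_right
      (f := fun x t : ℝ => x * t / (1 + x * t)) (Measurable.stronglyMeasurable ?_))
    simp only [Function.uncurry_def]
    fun_prop
  have key : ENNReal.ofReal (stieltjesConst γ) * ∫⁻ t, ENNReal.ofReal (t ^ γ) ∂ρ =
      ENNReal.ofReal γ⁻¹ * ∫⁻ u in Set.Ioo 0 a, ENNReal.ofReal (X u ^ (-γ)) := by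
    calc ENNReal.ofReal (stieltjesConst γ) * ∫⁻ t, ENNReal.ofReal (t ^ γ) ∂ρ
        = ∫⁻ t, (∫⁻ x in Set.Ioi (0 : ℝ),
            ENNReal.ofReal (x ^ (-γ - 1) * (x * t / (1 + x * t)))) ∂ρ := by
          rw [← lintegral_const_mul _ (by fun_prop)]
          refine lintegral_congr_ae ?_
          filter_upwards [hρ] with t ht
          exact (lintegral_rpow_mul_div_one_add h0 h1 ht).symm
      _ = ∫⁻ x in Set.Ioi (0 : ℝ), ∫⁻ t,
            ENNReal.ofReal (x ^ (-γ - 1) * (x * t / (1 + x * t))) ∂ρ := by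
          refine lintegral_lintegral_swap (Measurable.aemeasurable ?_)
          simp only [Function.uncurry_def]
          fun_prop
      _ = ∫⁻ x in Set.Ioi (0 : ℝ), ENNReal.ofReal (x ^ (-γ - 1)) * ENNReal.ofReal (negPsi ρ x) := by
          refine setLIntegral_congr_fun measurableSet_Ioi fun x hx => ?_
          have hx : 0 < x := hx
          have hp : 0 ≤ x ^ (-γ - 1) := by positivity
          simp only [ENNReal.ofReal_mul hp]
          rw [lintegral_const_mul _ (by fun_prop), negPsi,
            ofReal_integral_eq_lintegral_ofReal (integrable_negPsi_integrand hρ hx.le)]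
          filter_upwards [hρ] with t ht
          have h1 : 0 ≤ x * t := mul_nonneg hx.le ht
          simp only [Pi.zero_apply]
          positivity
      _ = ∫⁻ x in Set.Ioi (0 : ℝ), ∫⁻ u in Set.Ioo 0 a,
            Set.indicator {p : ℝ × ℝ | p.1 < negPsi ρ p.2}
              (fun p => ENNReal.ofReal (p.2 ^ (-γ - 1))) (u, x) := by
          refine setLIntegral_congr_fun measurableSet_Ioi fun x hx => ?_
          have hx : 0 < x := hx
          have hset : Set.Iio (negPsi ρ x) ∩ Set.Ioo 0 a = Set.Ioo 0 (negPsi ρ x) := by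
            ext u
            simp only [Set.mem_inter_iff, Set.mem_Iio, Set.mem_Ioo]
            exact ⟨fun h => ⟨h.2.1, h.1⟩, fun h => ⟨h.2, h.1, h.2.trans_le (hle x hx)⟩⟩
          have hind : ∀ u, Set.indicator {p : ℝ × ℝ | p.1 < negPsi ρ p.2}
              (fun p => ENNReal.ofReal (p.2 ^ (-γ - 1))) (u, x) =
              Set.indicator (Set.Iio (negPsi ρ x))
                (fun _ => ENNReal.ofReal (x ^ (-γ - 1))) u := fun u => rfl
          simp only [hind]
          rw [lintegral_indicator_const measurableSet_Iio,
            Measure.restrict_apply measurableSet_Iio, hset, Real.volume_Ioo, sub_zero]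
      _ = ∫⁻ u in Set.Ioo 0 a, ∫⁻ x in Set.Ioi (0 : ℝ),
            Set.indicator {p : ℝ × ℝ | p.1 < negPsi ρ p.2}
              (fun p => ENNReal.ofReal (p.2 ^ (-γ - 1))) (u, x) := by
          refine lintegral_lintegral_swap (Measurable.aemeasurable ?_)
          have hm : Measurable (Set.indicator {p : ℝ × ℝ | p.1 < negPsi ρ p.2}
              (fun p => ENNReal.ofReal (p.2 ^ (-γ - 1)))) :=
            Measurable.indicator (by fun_prop)
              (measurableSet_lt measurable_fst (hFm.comp measurable_snd))
          exact hm.comp measurable_swap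
      _ = ∫⁻ u in Set.Ioo 0 a, ENNReal.ofReal γ⁻¹ * ENNReal.ofReal (X u ^ (-γ)) := by
          refine setLIntegral_congr_fun measurableSet_Ioo fun u hu => ?_
          obtain ⟨hXu, hFu⟩ := hX u hu
          have hiff : ∀ x, 0 < x → (u < negPsi ρ x ↔ X u < x) := by
            intro x hx
            constructor
            · intro h
              by_contra hlt
              have := negPsi_monotoneOn hρ hx.le hXu.le (not_lt.1 hlt)
              rw [hFu] at this
              linarith
            · intro h
              have := negPsi_lt_negPsi hρ hXu.le h (by rw [hFu]; exact hu.1)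
              rwa [hFu] at this
          have hind : ∀ x ∈ Set.Ioi (0 : ℝ), Set.indicator {p : ℝ × ℝ | p.1 < negPsi ρ p.2}
              (fun p => ENNReal.ofReal (p.2 ^ (-γ - 1))) (u, x) =
              Set.indicator (Set.Ioi (X u)) (fun x => ENNReal.ofReal (x ^ (-γ - 1))) x := by
            intro x hx
            simp only [Set.indicator, Set.mem_ofPred_eq, hiff x hx, Set.mem_Ioi]
          have e : -γ - 1 + 1 = -γ := by ring
          rw [setLIntegral_congr_fun measurableSet_Ioi hind,
            setLIntegral_indicator measurableSet_Ioi,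
            Set.inter_eq_left.2 (Set.Ioi_subset_Ioi hXu.le),
            ← ofReal_integral_eq_lintegral_ofReal
              (integrableOn_Ioi_rpow_of_lt (by linarith) hXu),
            integral_Ioi_rpow_of_lt (by linarith) hXu, e, neg_div_neg_eq,
            ← ENNReal.ofReal_mul (by positivity), inv_mul_eq_div]
          filter_upwards [ae_restrict_mem measurableSet_Ioi] with x hx
          have hx : 0 < x := hXu.trans hx
          simp only [Pi.zero_apply]
          positivity
      _ = ENNReal.ofReal γ⁻¹ * ∫⁻ u in Set.Ioo 0 a, ENNReal.ofReal (X u ^ (-γ)) := by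
          rw [lintegral_const_mul'' _ (by fun_prop)]
  rw [integral_eq_lintegral_of_nonneg_ae, integral_eq_lintegral_of_nonneg_ae]
  · have hJ : 0 ≤ stieltjesConst γ :=
      setIntegral_nonneg measurableSet_Ioi fun y hy => by
        have hy : 0 < y := hy
        positivity
    have := congrArg ENNReal.toReal key
    rwa [ENNReal.toReal_mul, ENNReal.toReal_mul, ENNReal.toReal_ofReal hJ,
      ENNReal.toReal_ofReal (by positivity)] at this
  · filter_upwards [ae_restrict_mem measurableSet_Ioo] with u hu
    have := (hX u hu).1
    simp only [Pi.zero_apply]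
    positivity
  · exact AEMeasurable.aestronglyMeasurable (by fun_prop)
  · filter_upwards [hρ] with t ht
    simp only [Pi.zero_apply]
    positivity
  · exact AEMeasurable.aestronglyMeasurable (by fun_prop)

end MomentFormula

section DominatedConvergence

lemma tendsto_div_log_atTop : Tendsto (fun n : ℕ => (n : ℝ) / Real.log n) atTop atTop := by
  have h := Real.tendsto_pow_log_div_mul_add_atTop 1 0 1 one_ne_zero
  simp only [pow_one, one_mul, add_zero] at h
  have h2 : Tendsto (fun x : ℝ => Real.log x / x) atTop (𝓝[>] 0) := by
    refine tendsto_nhdsWithin_iff.2 ⟨h, ?_⟩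
    filter_upwards [eventually_gt_atTop 1] with x hx
    exact div_pos (Real.log_pos hx) (one_pos.trans hx)
  have h3 := h2.inv_tendsto_nhdsGT_zero.comp (tendsto_natCast_atTop_atTop (R := ℝ))
  simpa [Function.comp_def] using h3

lemma tendsto_div_log_rpow_inv_log :
    Tendsto (fun n : ℕ => ((n : ℝ) / Real.log n) ^ (Real.log n)⁻¹) atTop (𝓝 (Real.exp 1)) := by
  have hL : Tendsto (fun n : ℕ => Real.log n) atTop atTop :=
    Real.tendsto_log_atTop.comp tendsto_natCast_atTop_atTop
  have h := (Real.tendsto_pow_log_div_mul_add_atTop 1 0 1 one_ne_zero).comp hL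
  simp only [pow_one, one_mul, add_zero, Function.comp_def] at h
  have h2 : Tendsto (fun n : ℕ => Real.exp (1 - Real.log (Real.log n) / Real.log n)) atTop
      (𝓝 (Real.exp 1)) := by
    have := (Real.continuous_exp.tendsto _).comp (tendsto_const_nhds (x := (1 : ℝ)) |>.sub h)
    simpa [Function.comp_def] using this
  refine h2.congr' ?_
  filter_upwards [hL.eventually_gt_atTop 0, eventually_gt_atTop 0] with n hn hn0
  have hn0 : (0 : ℝ) < n := by exact_mod_cast hn0
  rw [Real.rpow_def_of_pos (by positivity), Real.log_div hn0.ne' hn.ne']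
  congr 1
  field_simp

lemma integrableOn_dominating {c : ℝ} (hc : 0 < c) :
    IntegrableOn (fun v : ℝ => (1 + v ^ (-(1 / 2) : ℝ)) * ((1 + c * v / 2) ^ 2)⁻¹) (Set.Ioi 0) := by
  rw [← Set.Ioc_union_Ioi_eq_Ioi zero_le_one]
  refine IntegrableOn.union ?_ ?_
  · refine Integrable.mono' (g := fun v : ℝ => 1 + v ^ (-(1 / 2) : ℝ))
      ((integrable_const 1).add (integrableOn_Ioc_rpow_neg (by norm_num)))
      (AEMeasurable.aestronglyMeasurable (by fun_prop)) ?_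
    filter_upwards [ae_restrict_mem measurableSet_Ioc] with v hv
    have hv0 := hv.1
    rw [Real.norm_of_nonneg (by positivity)]
    refine mul_le_of_le_one_right (by positivity) (inv_le_one_of_one_le₀ (one_le_pow₀ ?_))
    have : 0 ≤ c * v / 2 := by positivity
    linarith
  · refine Integrable.mono' (g := fun v : ℝ => 8 / c ^ 2 * v ^ (-2 : ℝ))
      ((integrableOn_Ioi_rpow_of_lt (by norm_num) one_pos).const_mul _)
      (AEMeasurable.aestronglyMeasurable (by fun_prop)) ?_
    filter_upwards [ae_restrict_mem measurableSet_Ioi] with v hv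
    have hv1 : 1 < v := hv
    have hv0 : 0 < v := one_pos.trans hv1
    rw [Real.norm_of_nonneg (by positivity)]
    have h1 : v ^ (-(1 / 2) : ℝ) ≤ 1 := Real.rpow_le_one_of_one_le_of_nonpos hv1.le (by norm_num)
    have h2 : ((1 + c * v / 2) ^ 2)⁻¹ ≤ ((c * v / 2) ^ 2)⁻¹ := by
      gcongr
      linarith
    have h3 : v ^ (-2 : ℝ) = (v ^ 2)⁻¹ := by
      rw [Real.rpow_neg hv0.le]
      norm_num
    calc (1 + v ^ (-(1 / 2) : ℝ)) * ((1 + c * v / 2) ^ 2)⁻¹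
        ≤ (1 + 1) * ((c * v / 2) ^ 2)⁻¹ := by gcongr
      _ = 8 / c ^ 2 * v ^ (-2 : ℝ) := by
        rw [h3]
        field_simp
        norm_num

lemma rpow_neg_inv_eq {u v k L σ : ℝ} {n : ℕ} (hk : k = n / L) (hk0 : 0 < k)
    (hv : 0 < v) (hu : u = k⁻¹ * v) (hu1 : u < 1) (hσ : 0 < σ) :
    (u / (1 - u) * σ ^ n) ^ (-L⁻¹) =
      (1 - u) ^ L⁻¹ * k ^ L⁻¹ * v ^ (-L⁻¹) * σ ^ (-k) := by
  have hu0 : 0 < u := by rw [hu]; positivity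
  have h1u : 0 < 1 - u := by linarith
  rw [Real.mul_rpow (by positivity) (by positivity), Real.div_rpow hu0.le h1u.le,
    Real.rpow_neg h1u.le, div_inv_eq_mul, hu, Real.mul_rpow (by positivity) hv.le, ← hu,
    Real.inv_rpow hk0.le, Real.rpow_neg hk0.le, inv_inv, ← Real.rpow_natCast,
    ← Real.rpow_mul hσ.le, hk]
  have : (n : ℝ) * -L⁻¹ = -(n / L) := by ring
  rw [this]
  ring

lemma tendsto_scaled_integral {a c : ℝ} (ha : 0 < a) (ha1 : a ≤ 1) (hc : 0 < c) {S g : ℝ → ℝ}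
    (hS : ∀ u ∈ Set.Ioo 0 a, 1 + c * u ≤ S u)
    (hSm : AEMeasurable S (volume.restrict (Set.Ioo 0 a)))
    (hg : ∀ v, 0 < v → Tendsto (fun x : ℝ => S (x⁻¹ * v) ^ (-x)) atTop (𝓝 (g v))) :
    Tendsto (fun n : ℕ => ((n : ℝ) / Real.log n) *
      ∫ u in Set.Ioo 0 a, (u / (1 - u) * S u ^ n) ^ (-(Real.log n)⁻¹)) atTop
      (𝓝 (∫ v in Set.Ioi 0, Real.exp 1 * g v)) := by
  set G : ℕ → ℝ → ℝ := fun n => Set.indicator (Set.Ioo 0 a)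
    (fun u => (u / (1 - u) * S u ^ n) ^ (-(Real.log n)⁻¹)) with hG
  set k : ℕ → ℝ := fun n => (n : ℝ) / Real.log n with hk
  have hkt : Tendsto k atTop atTop := tendsto_div_log_atTop
  have hL : Tendsto (fun n : ℕ => Real.log n) atTop atTop :=
    Real.tendsto_log_atTop.comp tendsto_natCast_atTop_atTop
  have hGm : ∀ n, AEMeasurable (G n) volume := fun n =>
    (aemeasurable_indicator_iff measurableSet_Ioo).2 (by fun_prop)
  have hconv : Tendsto (fun n => ∫ v in Set.Ioi 0, G n ((k n)⁻¹ * v)) atTop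
      (𝓝 (∫ v in Set.Ioi 0, Real.exp 1 * g v)) := by
    refine tendsto_integral_filter_of_dominated_convergence
      (fun v => Real.exp 1 * ((1 + v ^ (-(1 / 2) : ℝ)) * ((1 + c * v / 2) ^ 2)⁻¹)) ?_ ?_
      ((integrableOn_dominating hc).const_mul _) ?_
    · filter_upwards [hkt.eventually_gt_atTop 0] with n hn
      refine AEMeasurable.aestronglyMeasurable (AEMeasurable.restrict ?_)
      exact (hGm n).comp_quasiMeasurePreserving
        (Measure.quasiMeasurePreserving_smul volume (inv_pos.2 hn).ne')
    · filter_upwards [hkt.eventually_ge_atTop 2, hL.eventually_ge_atTop 2,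
        eventually_gt_atTop 0] with n hn hLn hn0
      filter_upwards [ae_restrict_mem measurableSet_Ioi] with v hv
      have hv : 0 < v := hv
      have hn0 : (1 : ℝ) ≤ n := by exact_mod_cast hn0
      have hk0 : 0 < k n := by linarith
      have hL0 : 0 < Real.log n := by linarith
      by_cases hu : (k n)⁻¹ * v ∈ Set.Ioo 0 a
      · have hSu := hS _ hu
        have hu0 := hu.1
        have hu1 : 0 < 1 - (k n)⁻¹ * v := by linarith [hu.2]
        have hb0 : 0 < 1 + c * ((k n)⁻¹ * v) := by positivity
        have hS0 : 0 < S ((k n)⁻¹ * v) := hb0.trans_le hSu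
        rw [hG]
        simp only
        rw [Set.indicator_of_mem hu, rpow_neg_inv_eq rfl hk0 hv rfl (by linarith) hS0,
          Real.norm_of_nonneg (by positivity)]
        have e1 : (1 - (k n)⁻¹ * v) ^ (Real.log n)⁻¹ ≤ 1 :=
          Real.rpow_le_one hu1.le (by linarith) (by positivity)
        have e2 : (k n) ^ (Real.log n)⁻¹ ≤ Real.exp 1 := by
          have : (n : ℝ) ^ (Real.log n)⁻¹ = Real.exp 1 := by
            rw [Real.rpow_def_of_pos (by linarith), mul_inv_cancel₀ hL0.ne']
          rw [← this]
          exact Real.rpow_le_rpow hk0.le (div_le_self (by linarith) (by linarith)) (by positivity)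
        have e3 : v ^ (-(Real.log n)⁻¹) ≤ 1 + v ^ (-(1 / 2) : ℝ) := by
          rcases le_total 1 v with h | h
          · have := Real.rpow_le_one_of_one_le_of_nonpos h
              (neg_nonpos.2 (inv_nonneg.2 hL0.le))
            have : 0 ≤ v ^ (-(1 / 2) : ℝ) := by positivity
            linarith
          · have : v ^ (-(Real.log n)⁻¹) ≤ v ^ (-(1 / 2) : ℝ) := by
              refine Real.rpow_le_rpow_of_exponent_ge hv h (neg_le_neg ?_)
              rw [one_div]
              gcongr
            linarith
        have e4 : S ((k n)⁻¹ * v) ^ (-(k n)) ≤ ((1 + c * v / 2) ^ 2)⁻¹ := by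
          rw [Real.rpow_neg hS0.le]
          refine inv_anti₀ (by positivity) ?_
          have h1 := one_add_mul_self_le_rpow_one_add (s := c * ((k n)⁻¹ * v))
            (by linarith) (p := k n / 2) (by linarith)
          have h2 : 1 + k n / 2 * (c * ((k n)⁻¹ * v)) = 1 + c * v / 2 := by
            field_simp
          rw [h2] at h1
          calc (1 + c * v / 2) ^ 2 ≤ ((1 + c * ((k n)⁻¹ * v)) ^ (k n / 2)) ^ 2 := by gcongr
            _ = (1 + c * ((k n)⁻¹ * v)) ^ (k n) := by
              rw [← Real.rpow_natCast, ← Real.rpow_mul hb0.le]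
              congr 1
              push_cast
              ring
            _ ≤ _ := Real.rpow_le_rpow hb0.le hSu hk0.le
        calc _ ≤ 1 * Real.exp 1 * (1 + v ^ (-(1 / 2) : ℝ)) * ((1 + c * v / 2) ^ 2)⁻¹ := by
              gcongr
          _ = _ := by ring
      · rw [hG]
        simp only
        rw [Set.indicator_of_notMem hu, norm_zero]
        positivity
    · filter_upwards [ae_restrict_mem measurableSet_Ioi] with v hv
      have hv : 0 < v := hv
      have hu : Tendsto (fun n => (k n)⁻¹ * v) atTop (𝓝 0) := by
        simpa using hkt.inv_tendsto_atTop.mul_const v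
      have hLi : Tendsto (fun n : ℕ => (Real.log n)⁻¹) atTop (𝓝 0) := hL.inv_tendsto_atTop
      have t1 : Tendsto (fun n => (1 - (k n)⁻¹ * v) ^ (Real.log n)⁻¹) atTop (𝓝 1) := by
        have := ((tendsto_const_nhds (x := (1 : ℝ))).sub hu).rpow hLi (Or.inl (by norm_num))
        simpa using this
      have t3 : Tendsto (fun n : ℕ => v ^ (-(Real.log n)⁻¹)) atTop (𝓝 1) := by
        have := (tendsto_const_nhds (x := v)).rpow hLi.neg (Or.inl hv.ne')
        simpa using this
      have := ((t1.mul tendsto_div_log_rpow_inv_log).mul t3).mul ((hg v hv).comp hkt)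
      rw [one_mul, mul_one] at this
      refine this.congr' ?_
      filter_upwards [hkt.eventually_gt_atTop 0, hu.eventually_lt_const ha] with n hn hun
      have hmem : (k n)⁻¹ * v ∈ Set.Ioo 0 a := ⟨by positivity, hun⟩
      have hS0 : 0 < S ((k n)⁻¹ * v) := lt_of_lt_of_le (by have := hmem.1; positivity) (hS _ hmem)
      rw [hG]
      simp only [Function.comp_def]
      rw [Set.indicator_of_mem hmem, rpow_neg_inv_eq rfl hn hv rfl (by linarith) hS0]
  refine hconv.congr' ?_
  filter_upwards [hkt.eventually_gt_atTop 0] with n hn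
  rw [integral_comp_mul_left_Ioi (G n) 0 (inv_pos.2 hn), mul_zero, inv_inv, smul_eq_mul, hG]
  simp only
  rw [setIntegral_indicator measurableSet_Ioo, Set.inter_eq_right.2 Set.Ioo_subset_Ioi_self]

end DominatedConvergence

section SPowerLimit

variable {μ : Measure ℝ} [IsProbabilityMeasure μ] {a : ℝ} {s : ℝ → ℝ}

/-- Near zero, `S(-u) = 1 + u D(u)` where `D` has the limit `l` whenever
`∫ (1 - t)² / (1 + x t) dμ(t)` tends to `l` as `x → 0⁺`. -/
lemma tendsto_sTransform_slope (hμ : ∀ᵐ t ∂μ, 0 ≤ t) (hm1 : Integrable (fun t : ℝ => t) μ)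
    (hmean : ∫ t, t ∂μ = 1) (ha : 0 < a)
    (hs : ∀ u ∈ Set.Ioo 0 a, 0 < s u ∧ negPsi μ (s u) = u) {v : ℝ} (hv : 0 < v) :
    ∃ D : ℝ → ℝ, ∃ p : ℝ → ℝ, Tendsto p atTop (𝓝 1) ∧
      (∀ x, D x = (∫ t, (1 - t) ^ 2 / (1 + s (x⁻¹ * v) * t) ∂μ) * p x) ∧
      Tendsto (fun x => s (x⁻¹ * v)) atTop (𝓝[>] 0) ∧
      ∀ᶠ x in atTop, (1 - x⁻¹ * v) / (x⁻¹ * v) * s (x⁻¹ * v) = 1 + x⁻¹ * v * D x := by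
  have hu : Tendsto (fun x : ℝ => x⁻¹ * v) atTop (𝓝[>] 0) := by
    refine tendsto_nhdsWithin_iff.2 ⟨by simpa using tendsto_inv_atTop_zero.mul_const v, ?_⟩
    filter_upwards [eventually_gt_atTop 0] with x hx
    exact mul_pos (inv_pos.2 hx) hv
  have hst : Tendsto (fun x => s (x⁻¹ * v)) atTop (𝓝[>] 0) :=
    (tendsto_negPsi_inverse_zero hμ hmean ha hs).comp hu
  have hp : Tendsto (fun y => ((1 + y) * (∫ t, t / (1 + y * t) ∂μ) ^ 2)⁻¹) (𝓝[>] 0) (𝓝 1) := by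
    have h1 : Tendsto (fun y : ℝ => 1 + y) (𝓝[>] 0) (𝓝 (1 + 0)) :=
      (tendsto_const_nhds.add tendsto_id).mono_left nhdsWithin_le_nhds
    have := (h1.mul ((tendsto_integral_div_one_add hμ hm1 hmean).pow 2)).inv₀ (by norm_num)
    simpa using this
  refine ⟨fun x => (∫ t, (1 - t) ^ 2 / (1 + s (x⁻¹ * v) * t) ∂μ) *
      ((1 + s (x⁻¹ * v)) * (∫ t, t / (1 + s (x⁻¹ * v) * t) ∂μ) ^ 2)⁻¹,
    fun x => ((1 + s (x⁻¹ * v)) * (∫ t, t / (1 + s (x⁻¹ * v) * t) ∂μ) ^ 2)⁻¹,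
    hp.comp hst, fun x => rfl, hst, ?_⟩
  filter_upwards [hu.eventually (Ioo_mem_nhdsGT ha)] with x hx
  rw [sTransform_eq_one_add hμ hm1 hmean (hs _ hx).1 hx.1 (hs _ hx).2, div_eq_mul_inv _ (_ * _)]

lemma tendsto_sTransform_rpow_of_integrable (hμ : ∀ᵐ t ∂μ, 0 ≤ t)
    (hm1 : Integrable (fun t : ℝ => t) μ) (hmean : ∫ t, t ∂μ = 1) (ha : 0 < a)
    (hs : ∀ u ∈ Set.Ioo 0 a, 0 < s u ∧ negPsi μ (s u) = u)
    (hm2 : Integrable (fun t : ℝ => t ^ 2) μ) {v : ℝ} (hv : 0 < v) :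
    Tendsto (fun x : ℝ => ((1 - x⁻¹ * v) / (x⁻¹ * v) * s (x⁻¹ * v)) ^ (-x)) atTop
      (𝓝 (Real.exp (-((∫ t, t ^ 2 ∂μ) - (∫ t, t ∂μ) ^ 2) * v))) := by
  obtain ⟨D, p, hp, hD, hst, heq⟩ := tendsto_sTransform_slope hμ hm1 hmean ha hs hv
  set V := (∫ t, t ^ 2 ∂μ) - (∫ t, t ∂μ) ^ 2
  have hDt : Tendsto D atTop (𝓝 V) := by
    have := ((tendsto_integral_sq_div_one_add hμ hm1 hmean hm2).comp hst).mul hp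
    rw [mul_one] at this
    exact this.congr fun x => (hD x).symm
  have h1 : Tendsto (fun x => x * (x⁻¹ * v * D x)) atTop (𝓝 (V * v)) := by
    rw [mul_comm]
    refine (hDt.const_mul v).congr' ?_
    filter_upwards [eventually_ne_atTop 0] with x hx
    field_simp
  have h2 := (Real.tendsto_one_add_rpow_exp_of_tendsto h1).inv₀ (Real.exp_ne_zero _)
  rw [← Real.exp_neg, ← neg_mul] at h2
  have h3 : Tendsto (fun x => x⁻¹ * v * D x) atTop (𝓝 0) := by
    have := (tendsto_inv_atTop_zero.mul_const v).mul hDt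
    simpa using this
  refine h2.congr' ?_
  filter_upwards [heq, h3.eventually_const_lt (show (-1 : ℝ) < 0 by norm_num)] with x hx hx1
  rw [hx, Real.rpow_neg (by linarith)]

lemma tendsto_sTransform_rpow_of_not_integrable (hμ : ∀ᵐ t ∂μ, 0 ≤ t)
    (hm1 : Integrable (fun t : ℝ => t) μ) (hmean : ∫ t, t ∂μ = 1) (ha : 0 < a)
    (hs : ∀ u ∈ Set.Ioo 0 a, 0 < s u ∧ negPsi μ (s u) = u)
    (hm2 : ¬ Integrable (fun t : ℝ => t ^ 2) μ) {v : ℝ} (hv : 0 < v) :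
    Tendsto (fun x : ℝ => ((1 - x⁻¹ * v) / (x⁻¹ * v) * s (x⁻¹ * v)) ^ (-x)) atTop (𝓝 0) := by
  obtain ⟨D, p, hp, hD, hst, heq⟩ := tendsto_sTransform_slope hμ hm1 hmean ha hs hv
  have hDt : Tendsto D atTop atTop :=
    (((tendsto_integral_sq_div_one_add_atTop hμ hm1 hm2).comp hst).atTop_mul_pos one_pos hp).congr
      fun x => (hD x).symm
  have hlow : Tendsto (fun x => 1 + v * D x) atTop atTop :=
    tendsto_atTop_add_const_left _ _ (hDt.const_mul_atTop hv)
  have h1 : Tendsto (fun x => (1 + x⁻¹ * v * D x) ^ x) atTop atTop := by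
    refine tendsto_atTop_mono' _ ?_ hlow
    filter_upwards [eventually_ge_atTop 1, hDt.eventually_ge_atTop 0] with x hx hDx
    have hx0 : 0 < x := by linarith
    have h0 : 0 ≤ x⁻¹ * v * D x := by positivity
    refine le_trans (le_of_eq ?_) (one_add_mul_self_le_rpow_one_add (by linarith) hx)
    field_simp
  refine h1.inv_tendsto_atTop.congr' ?_
  filter_upwards [heq, eventually_ge_atTop 1, hDt.eventually_ge_atTop 0] with x hx hx1 hDx
  have h0 : 0 ≤ x⁻¹ * v * D x := by positivity
  rw [hx, Real.rpow_neg (by linarith), Pi.inv_apply]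

end SPowerLimit

lemma eq_of_negPsi_eq {ρ : Measure ℝ} [IsProbabilityMeasure ρ] (hρ : ∀ᵐ t ∂ρ, 0 ≤ t)
    {x y u : ℝ} (hx : 0 < x) (hy : 0 < y) (hu : 0 < u) (hxu : negPsi ρ x = u)
    (hyu : negPsi ρ y = u) : x = y := by
  rcases lt_trichotomy x y with h | h | h
  · have := negPsi_lt_negPsi hρ hx.le h (hxu ▸ hu)
    linarith
  · exact h
  · have := negPsi_lt_negPsi hρ hy.le h (hyu ▸ hu)
    linarith

lemma RealizesFreePower.exists_inverse {μ ν : Measure ℝ} {n : ℕ} (hn : n ≠ 0)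
    (h : RealizesFreePower μ ν n) :
    ∃ s : ℝ → ℝ, ∀ u ∈ Set.Ioo 0 (1 - (μ {0}).toReal),
      (0 < s u ∧ negPsi μ (s u) = u) ∧
      negPsi ν (u / (1 - u) * ((1 - u) / u * s u) ^ n) = u := by
  obtain ⟨χ, h1, h2⟩ := h
  refine ⟨fun u => -χ (-u), fun u hu => ?_⟩
  have hz : -u ∈ Set.Ioo ((μ {0}).toReal - 1) 0 := ⟨by linarith [hu.2], by linarith [hu.1]⟩
  obtain ⟨ha, hb⟩ := h1 _ hz
  have hc := h2 _ hz
  have hu0 : u ≠ 0 := hu.1.ne'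
  have hu1 : 1 - u ≠ 0 := by
    have : 0 ≤ (μ {0}).toReal := ENNReal.toReal_nonneg
    linarith [hu.2]
  refine ⟨⟨by linarith, ?_⟩, ?_⟩
  · rw [← neg_neg (χ (-u)), psi_neg] at hb
    linarith
  · obtain ⟨m, rfl⟩ := Nat.exists_eq_succ_of_ne_zero hn
    have : ((-u + 1) / -u) ^ (m.succ - 1) * χ (-u) ^ m.succ =
        -(u / (1 - u) * ((1 - u) / u * -χ (-u)) ^ m.succ) := by
      have e : (-u + 1) / -u * χ (-u) = (1 - u) / u * -χ (-u) := by
        field_simp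
        ring
      rw [Nat.succ_sub_one, pow_succ (χ (-u)), ← mul_assoc, ← mul_pow, e, Nat.succ_eq_add_one,
        pow_succ]
      field_simp
    rw [this, psi_neg] at hc
    linarith

section FreePower

variable {μ ν : Measure ℝ} [IsProbabilityMeasure μ] [IsProbabilityMeasure ν]

lemma negPsi_le_of_freePower (hμ : ∀ᵐ t ∂μ, 0 ≤ t) (hν : ∀ᵐ t ∂ν, 0 ≤ t)
    {a : ℝ} (ha : 0 < a) (hle : ∀ x, 0 ≤ x → negPsi μ x ≤ a) {s X : ℝ → ℝ}
    (hs : ∀ u ∈ Set.Ioo 0 a, 0 < s u ∧ negPsi μ (s u) = u)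
    (hX : ∀ u ∈ Set.Ioo 0 a, s u ≤ X u ∧ negPsi ν (X u) = u) {x : ℝ} (hx : 0 < x) :
    negPsi ν x ≤ a := by
  by_contra! h
  have h1 : ∀ u ∈ Set.Ioo 0 a, u ≤ negPsi μ x := by
    intro u hu
    have hXx : X u ≤ x := by
      by_contra! hlt
      have := negPsi_monotoneOn hν hx.le (hx.trans hlt).le hlt.le
      rw [(hX u hu).2] at this
      linarith [hu.2]
    have := negPsi_monotoneOn hμ (hs u hu).1.le hx.le ((hX u hu).1.trans hXx)
    rwa [(hs u hu).2] at this
  have h2 : a ≤ negPsi μ x := by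
    refine le_of_forall_lt_imp_le_of_dense fun u hu => ?_
    rcases le_or_gt u 0 with hu0 | hu0
    · exact hu0.trans (negPsi_nonneg hμ hx.le)
    · exact h1 u ⟨hu0, hu⟩
  have h3 := negPsi_lt_negPsi hμ hx.le (lt_add_one x) (ha.trans_le h2)
  linarith [hle (x + 1) (by linarith)]

/-- The fractional moment of `μ^{⊠ n}` as an integral of the `S`-transform of `μ`. -/
lemma stieltjesConst_mul_integral_rpow_freePower (hμ : ∀ᵐ t ∂μ, 0 ≤ t)
    (hν : ∀ᵐ t ∂ν, 0 ≤ t) (hm1 : Integrable (fun t : ℝ => t) μ) (hmean : ∫ t, t ∂μ = 1)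
    {n : ℕ} (hn : n ≠ 0) (h : RealizesFreePower μ ν n) {s : ℝ → ℝ}
    (hs : ∀ u ∈ Set.Ioo 0 (1 - (μ {0}).toReal), 0 < s u ∧ negPsi μ (s u) = u)
    {γ : ℝ} (h0 : 0 < γ) (h1 : γ < 1) :
    stieltjesConst γ * ∫ t, t ^ γ ∂ν = γ⁻¹ * ∫ u in Set.Ioo 0 (1 - (μ {0}).toReal),
      (u / (1 - u) * ((1 - u) / u * s u) ^ n) ^ (-γ) := by
  have hle : ∀ x, 0 ≤ x → negPsi μ x ≤ 1 - (μ {0}).toReal := fun x hx =>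
    negPsi_le_one_sub hμ hx
  have ha : 0 < 1 - (μ {0}).toReal :=
    (negPsi_pos hμ hmean one_pos).trans_le (hle 1 zero_le_one)
  obtain ⟨s', hs'⟩ := h.exists_inverse hn
  have hX : ∀ u ∈ Set.Ioo 0 (1 - (μ {0}).toReal),
      negPsi ν (u / (1 - u) * ((1 - u) / u * s u) ^ n) = u := by
    intro u hu
    have := eq_of_negPsi_eq hμ (hs u hu).1 (hs' u hu).1.1 hu.1 (hs u hu).2 (hs' u hu).1.2
    rw [this]
    exact (hs' u hu).2
  have hsX : ∀ u ∈ Set.Ioo 0 (1 - (μ {0}).toReal),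
      s u ≤ u / (1 - u) * ((1 - u) / u * s u) ^ n := by
    intro u hu
    have hu0 : 0 < u := hu.1
    have hu1 : 0 < 1 - u := by
      have : 0 ≤ (μ {0}).toReal := ENNReal.toReal_nonneg
      linarith [hu.2]
    have hS := one_add_mul_le_sTransform hμ hm1 hmean (hs u hu).1 hu0 (hs u hu).2
    have hc : 0 ≤ ∫ t, (1 - t) ^ 2 / (1 + 1 * t) ∂μ := by
      refine integral_nonneg_of_ae ?_
      filter_upwards [hμ] with t ht
      simp only [Pi.zero_apply]
      positivity
    have hS1 : 1 ≤ (1 - u) / u * s u := by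
      have := mul_nonneg hc hu0.le
      linarith
    calc s u = u / (1 - u) * ((1 - u) / u * s u) := by field_simp
      _ ≤ u / (1 - u) * ((1 - u) / u * s u) ^ n := by
        gcongr
        exact le_self_pow₀ hS1 hn
  refine stieltjesConst_mul_integral_rpow hν h0 h1
    (fun u hu => ⟨(hs u hu).1.trans_le (hsX u hu), hX u hu⟩) fun x hx => ?_
  exact negPsi_le_of_freePower hμ hν ha hle hs (fun u hu => ⟨hsX u hu, hX u hu⟩) hx

end FreePower

/-- The rescaled logarithmic fractional moments converge to `∫₀^∞ e g(v) dv` as soon as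
`S(-v/x)^{-x}` converges pointwise to `g(v)`. -/
lemma tendsto_fractional_moment_freePower {μ : Measure ℝ} [IsProbabilityMeasure μ]
    (hμ : ∀ᵐ t ∂μ, 0 ≤ t) (hnd : ∀ a : ℝ, μ ≠ Measure.dirac a)
    (hm1 : Integrable (fun t : ℝ => t) μ) (hmean : ∫ t, t ∂μ = 1)
    {ν : ℕ → Measure ℝ} (hprob : ∀ n, IsProbabilityMeasure (ν n))
    (hνnn : ∀ n, ∀ᵐ t ∂(ν n), 0 ≤ t) (hν : ∀ n, 2 ≤ n → RealizesFreePower μ (ν n) n)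
    {s g : ℝ → ℝ} (hs : ∀ u ∈ Set.Ioo 0 (1 - (μ {0}).toReal), 0 < s u ∧ negPsi μ (s u) = u)
    (hg : ∀ v, 0 < v → Tendsto
      (fun x : ℝ => ((1 - x⁻¹ * v) / (x⁻¹ * v) * s (x⁻¹ * v)) ^ (-x)) atTop (𝓝 (g v))) :
    Tendsto (fun n : ℕ => ((n : ℝ) / Real.log (n : ℝ)) *
      ∫ t, t ^ ((Real.log (n : ℝ))⁻¹) ∂(ν n)) atTop (𝓝 (∫ v in Set.Ioi 0, Real.exp 1 * g v)) := by
  have ha : 0 < 1 - (μ {0}).toReal :=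
    (negPsi_pos hμ hmean one_pos).trans_le (negPsi_le_one_sub hμ zero_le_one)
  have ha1 : 1 - (μ {0}).toReal ≤ 1 := by
    have : 0 ≤ (μ {0}).toReal := ENNReal.toReal_nonneg
    linarith
  have hsmono : MonotoneOn s (Set.Ioo 0 (1 - (μ {0}).toReal)) := by
    intro u hu v hv huv
    by_contra! h
    have := negPsi_lt_negPsi hμ (hs v hv).1.le h (by rw [(hs v hv).2]; exact hv.1)
    rw [(hs u hu).2, (hs v hv).2] at this
    linarith
  have hsm : AEMeasurable s (volume.restrict (Set.Ioo 0 (1 - (μ {0}).toReal))) :=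
    aemeasurable_restrict_of_monotoneOn measurableSet_Ioo hsmono
  have hmain := tendsto_scaled_integral ha ha1 (integral_sq_div_one_add_pos hμ hm1 hnd)
    (S := fun u => (1 - u) / u * s u)
    (fun u hu => one_add_mul_le_sTransform hμ hm1 hmean (hs u hu).1 hu.1 (hs u hu).2)
    (by fun_prop) hg
  have hL : Tendsto (fun n : ℕ => Real.log n) atTop atTop :=
    Real.tendsto_log_atTop.comp tendsto_natCast_atTop_atTop
  have hγ : Tendsto (fun n : ℕ => (Real.log n)⁻¹) atTop (𝓝[>] 0) :=
    tendsto_inv_atTop_nhdsGT_zero.comp hL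
  have hJ := tendsto_mul_stieltjesConst.comp hγ
  have hlim := hmain.div hJ one_ne_zero
  rw [div_one] at hlim
  refine hlim.congr' ?_
  filter_upwards [eventually_ge_atTop 2, hγ.eventually (Ioo_mem_nhdsGT one_pos),
    hJ.eventually_const_lt one_pos] with n hn hγn hJn
  have := hprob n
  have key := stieltjesConst_mul_integral_rpow_freePower hμ (hνnn n) hm1 hmean (by omega)
    (hν n hn) hs hγn.1 hγn.2
  simp only [Function.comp_def] at hJn
  rw [Pi.div_apply, Function.comp_apply, div_eq_iff hJn.ne', mul_assoc]
  congr 1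
  have hγ0 := hγn.1.ne'
  calc _ = (Real.log n)⁻¹ * ((Real.log n)⁻¹⁻¹ * ∫ u in Set.Ioo 0 (1 - (μ {0}).toReal),
        (u / (1 - u) * ((1 - u) / u * s u) ^ n) ^ (-(Real.log n)⁻¹)) := by
        rw [mul_inv_cancel_left₀ hγ0]
    _ = _ := by
      rw [← key]
      ring

/-- For a non-Dirac probability measure `μ` on `[0,∞)` with unit mean and
`γ_n = 1/log n`: if `m₂(μ) < ∞` then `(n/log n) · m_{γ_n}(μ^{⊠n}) → e/Var(μ)`,
and if `m₂(μ) = ∞` then `(n/log n) · m_{γ_n}(μ^{⊠n}) → 0`. -/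
theorem log_fractional_moment_asymptotics_free_power
    (μ : Measure ℝ) [IsProbabilityMeasure μ] (hsupp : μ (Set.Iio 0) = 0)
    (hnd : ∀ a : ℝ, μ ≠ Measure.dirac a)
    (hm1 : Integrable (fun t : ℝ => t) μ) (hmean : ∫ t, t ∂μ = 1)
    (ν : ℕ → Measure ℝ) (hprob : ∀ n, IsProbabilityMeasure (ν n))
    (hνsupp : ∀ n, (ν n) (Set.Iio 0) = 0)
    (hν : ∀ n, 2 ≤ n → RealizesFreePower μ (ν n) n) :
    (Integrable (fun t : ℝ => t ^ 2) μ →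
      Tendsto (fun n : ℕ => ((n : ℝ) / Real.log (n : ℝ)) *
          ∫ t, t ^ ((Real.log (n : ℝ))⁻¹) ∂(ν n)) atTop
        (𝓝 (Real.exp 1 / ((∫ t, t ^ 2 ∂μ) - (∫ t, t ∂μ) ^ 2)))) ∧
    (¬ Integrable (fun t : ℝ => t ^ 2) μ →
      Tendsto (fun n : ℕ => ((n : ℝ) / Real.log (n : ℝ)) *
          ∫ t, t ^ ((Real.log (n : ℝ))⁻¹) ∂(ν n)) atTop (𝓝 0)) := by
  have hμ := ae_nonneg_of_measure_Iio hsupp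
  have hνnn := fun n => ae_nonneg_of_measure_Iio (hνsupp n)
  obtain ⟨s, hs'⟩ := (hν 2 le_rfl).exists_inverse two_ne_zero
  have hs := fun u hu => (hs' u hu).1
  have ha : 0 < 1 - (μ {0}).toReal :=
    (negPsi_pos hμ hmean one_pos).trans_le (negPsi_le_one_sub hμ zero_le_one)
  refine ⟨fun hm2 => ?_, fun hm2 => ?_⟩
  · have hV := variance_pos_of_not_dirac hμ hm1 hmean hm2 hnd
    have h := tendsto_fractional_moment_freePower hμ hnd hm1 hmean hprob hνnn hν hs
      (fun v hv => tendsto_sTransform_rpow_of_integrable hμ hm1 hmean ha hs hm2 hv)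
    rw [integral_const_mul, integral_exp_mul_Ioi (neg_lt_zero.2 hV), mul_zero, Real.exp_zero,
      neg_div_neg_eq, mul_one_div] at h
    exact h
  · have h := tendsto_fractional_moment_freePower (g := fun _ => 0) hμ hnd hm1 hmean hprob hνnn
      hν hs (fun v hv => tendsto_sTransform_rpow_of_not_integrable hμ hm1 hmean ha hs hm2 hv)
    simpa using h
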